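/- arXiv:2106.00636 — 2 statements merged into one kernel-verified Lean document; each statement's English description precedes it below -/
import Mathlib

section
/- Let (H_n)_{n∈ℕ} be a sequence of closed subspaces of a complex Hilbert space 𝓗, and for each n let sin(H_n, H_{ℕ∖{n}}) := inf{ dist(h, M_n) : h ∈ H_n, ‖h‖ = 1 }, where M_n is the closed linear span of all H_j with j ≠ n. Assume the infinite product ∏_{n∈ℕ} sin(H_n, H_{ℕ∖{n}}) is positive, i.e. there exists δ > 0 such that ∏_{n∈s} sin(H_n, H_{ℕ∖{n}}) ≥ δ for every finite subset s ⊂ ℕ. Then there exists a constant C < ∞ such that for every finite set J ⊂ ℕ, every subset σ ⊆ J, and every choice of vectors x_j ∈ H_j (j ∈ J), one has ‖Σ_{j∈σ} x_j‖ ≤ C · ‖Σ_{j∈J} x_j‖. In other words, the coordinate projections P_σ, which act as the identity on each H_j with j ∈ σ and as zero on each H_j with j ∉ σ, are uniformly bounded over all finite σ. -/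
open Metric

/-- The closed linear span of all the subspaces `H j` with `j ≠ n`. -/
noncomputable def closedSpanOthers {𝓗 : Type*} [NormedAddCommGroup 𝓗]
    [InnerProductSpace ℂ 𝓗] (H : ℕ → Submodule ℂ 𝓗) (n : ℕ) : Submodule ℂ 𝓗 :=
  (⨆ j ≠ n, H j).topologicalClosure

/-- `sin(H_n, H_{ℕ∖{n}})`: the infimum of the distances of unit vectors of `H n`
to the closed linear span of the other subspaces. -/
noncomputable def sinToOthers {𝓗 : Type*} [NormedAddCommGroup 𝓗]
    [InnerProductSpace ℂ 𝓗] (H : ℕ → Submodule ℂ 𝓗) (n : ℕ) : ℝ :=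
  sInf {r : ℝ | ∃ h : 𝓗, h ∈ H n ∧ ‖h‖ = 1 ∧
    r = infDist h ((closedSpanOthers H n : Submodule ℂ 𝓗) : Set 𝓗)}

section SinToOthers

variable {𝓗 : Type*} [NormedAddCommGroup 𝓗] [InnerProductSpace ℂ 𝓗]

lemma sinToOthers_nonneg (H : ℕ → Submodule ℂ 𝓗) (n : ℕ) : 0 ≤ sinToOthers H n := by
  apply Real.sInf_nonneg
  rintro r ⟨h, -, -, rfl⟩
  exact infDist_nonneg

lemma sinToOthers_le_norm_add (H : ℕ → Submodule ℂ 𝓗) {n : ℕ} {h m : 𝓗}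
    (hh : h ∈ H n) (h1 : ‖h‖ = 1) (hm : m ∈ closedSpanOthers H n) :
    sinToOthers H n ≤ ‖h + m‖ := by
  have hbdd : BddBelow {r : ℝ | ∃ h : 𝓗, h ∈ H n ∧ ‖h‖ = 1 ∧
      r = infDist h ((closedSpanOthers H n : Submodule ℂ 𝓗) : Set 𝓗)} := by
    refine ⟨0, ?_⟩
    rintro r ⟨h, -, -, rfl⟩
    exact infDist_nonneg
  refine (csInf_le hbdd ⟨h, hh, h1, rfl⟩).trans ?_
  refine (infDist_le_dist_of_mem (neg_mem hm)).trans_eq ?_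
  rw [dist_eq_norm, sub_neg_eq_add]

lemma sinToOthers_le_one (H : ℕ → Submodule ℂ 𝓗) (n : ℕ) : sinToOthers H n ≤ 1 := by
  by_cases hex : ∃ h ∈ H n, ‖h‖ = 1
  · obtain ⟨h, hh, h1⟩ := hex
    simpa [h1] using sinToOthers_le_norm_add H hh h1 (zero_mem _)
  · have hempty : {r : ℝ | ∃ h : 𝓗, h ∈ H n ∧ ‖h‖ = 1 ∧
        r = infDist h ((closedSpanOthers H n : Submodule ℂ 𝓗) : Set 𝓗)} = ∅ := by
      refine Set.eq_empty_of_forall_notMem ?_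
      rintro r ⟨h, hh, h1, -⟩
      exact hex ⟨h, hh, h1⟩
    rw [sinToOthers, hempty, Real.sInf_empty]
    exact zero_le_one

lemma sinToOthers_mul_norm_left_le (H : ℕ → Submodule ℂ 𝓗) {n : ℕ} {h m : 𝓗}
    (hh : h ∈ H n) (hm : m ∈ closedSpanOthers H n) :
    sinToOthers H n * ‖h‖ ≤ ‖h + m‖ := by
  rcases eq_or_ne h 0 with rfl | h0
  · simp
  have hpos : 0 < ‖h‖ := norm_pos_iff.mpr h0
  have key := sinToOthers_le_norm_add H (Submodule.smul_mem _ ((‖h‖⁻¹ : ℝ) : ℂ) hh)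
    (by rw [norm_smul, Complex.norm_real, norm_inv, norm_norm, inv_mul_cancel₀ hpos.ne'])
    (Submodule.smul_mem _ ((‖h‖⁻¹ : ℝ) : ℂ) hm)
  rw [← smul_add, norm_smul, Complex.norm_real, norm_inv, norm_norm, inv_mul_eq_div] at key
  exact (le_div_iff₀ hpos).mp key

/-- The angle between two subspaces is symmetric: a lower bound for the distance of `h` to all
real multiples of `m` gives the same relative lower bound for `‖h + m‖` in terms of `‖m‖`. -/
lemma mul_norm_right_le_norm_add {s : ℝ} (hs : 0 ≤ s) {h m : 𝓗} (h0 : h ≠ 0)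
    (hmul : ∀ t : ℝ, s * ‖h‖ ≤ ‖h + (t : ℂ) • m‖) : s * ‖m‖ ≤ ‖h + m‖ := by
  set p : ℝ := RCLike.re (inner ℂ h m) with hp
  have hexp : ∀ t : ℝ, ‖h + (t : ℂ) • m‖ ^ 2 = ‖h‖ ^ 2 + 2 * (t * p) + t ^ 2 * ‖m‖ ^ 2 := by
    intro t
    rw [norm_add_sq (𝕜 := ℂ), inner_smul_right, norm_smul, Complex.norm_real, mul_pow,
      Real.norm_eq_abs, sq_abs]
    simp [hp]
  have hdisc : discrim (‖m‖ ^ 2) (2 * p) (‖h‖ ^ 2 - s ^ 2 * ‖h‖ ^ 2) ≤ 0 := by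
    refine discrim_le_zero fun t => ?_
    have := pow_le_pow_left₀ (by positivity) (hmul t) 2
    rw [hexp t] at this
    linarith
  have hsum : ‖h + m‖ ^ 2 = ‖h‖ ^ 2 + 2 * p + ‖m‖ ^ 2 := by simpa using hexp 1
  have hpos : 0 < ‖h‖ ^ 2 := by positivity
  refine le_of_sq_le_sq ?_ (norm_nonneg _)
  refine le_of_mul_le_mul_left ?_ hpos
  rw [hsum]
  rw [discrim] at hdisc
  linarith [sq_nonneg (‖h‖ ^ 2 + p)]

lemma sinToOthers_mul_norm_right_le (H : ℕ → Submodule ℂ 𝓗) {n : ℕ} {h m : 𝓗}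
    (hh : h ∈ H n) (hm : m ∈ closedSpanOthers H n) :
    sinToOthers H n * ‖m‖ ≤ ‖h + m‖ := by
  rcases eq_or_ne h 0 with rfl | h0
  · rw [zero_add]
    exact mul_le_of_le_one_left (norm_nonneg _) (sinToOthers_le_one H n)
  · exact mul_norm_right_le_norm_add (sinToOthers_nonneg H n) h0 fun t =>
      sinToOthers_mul_norm_left_le H hh (Submodule.smul_mem _ _ hm)

lemma sum_mem_closedSpanOthers (H : ℕ → Submodule ℂ 𝓗) {n : ℕ} {s : Finset ℕ} (hn : n ∉ s)
    {x : ℕ → 𝓗} (hx : ∀ j ∈ s, x j ∈ H j) : ∑ j ∈ s, x j ∈ closedSpanOthers H n := by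
  refine Submodule.le_topologicalClosure _ (Submodule.sum_mem _ fun j hj => ?_)
  have hjn : j ≠ n := fun e => hn (e ▸ hj)
  exact Submodule.mem_iSup_of_mem j (Submodule.mem_iSup_of_mem hjn (hx j hj))

lemma prod_sinToOthers_mul_norm_sum_le (H : ℕ → Submodule ℂ 𝓗) (x : ℕ → 𝓗)
    (σ τ : Finset ℕ) (hdisj : Disjoint σ τ) (hx : ∀ j ∈ σ ∪ τ, x j ∈ H j) :
    (∏ n ∈ τ, sinToOthers H n) * ‖∑ j ∈ σ, x j‖ ≤ ‖∑ j ∈ σ ∪ τ, x j‖ := by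
  induction τ using Finset.induction_on with
  | empty => simp
  | insert k τ hk ih =>
    rw [Finset.disjoint_insert_right] at hdisj
    rw [Finset.union_insert] at hx ⊢
    have hx' : ∀ j ∈ σ ∪ τ, x j ∈ H j := fun j hj => hx j (Finset.mem_insert_of_mem hj)
    have hk' : k ∉ σ ∪ τ := by simp [hk, hdisj.1]
    rw [Finset.prod_insert hk, Finset.sum_insert hk', mul_assoc]
    exact (mul_le_mul_of_nonneg_left (ih hdisj.2 hx') (sinToOthers_nonneg H k)).trans
      (sinToOthers_mul_norm_right_le H (hx k (Finset.mem_insert_self _ _))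
        (sum_mem_closedSpanOthers H hk' hx'))

end SinToOthers

/-- if `∏ₙ sin(H_n, H_{ℕ∖{n}}) > 0` then the coordinate projections
`P_σ` are uniformly bounded over all finite `σ`. -/
theorem stmt_1 {𝓗 : Type*} [NormedAddCommGroup 𝓗] [InnerProductSpace ℂ 𝓗]
    [CompleteSpace 𝓗]
    (H : ℕ → Submodule ℂ 𝓗) (hclosed : ∀ n, IsClosed ((H n : Set 𝓗)))
    (hprod : ∃ δ : ℝ, 0 < δ ∧ ∀ s : Finset ℕ, δ ≤ ∏ n ∈ s, sinToOthers H n) :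
    ∃ C : ℝ, ∀ (J σ : Finset ℕ), σ ⊆ J →
      ∀ x : ℕ → 𝓗, (∀ j ∈ J, x j ∈ H j) →
        ‖∑ j ∈ σ, x j‖ ≤ C * ‖∑ j ∈ J, x j‖ := by
  obtain ⟨δ, hδ, hle⟩ := hprod
  refine ⟨δ⁻¹, fun J σ hσ x hx => ?_⟩
  have hunion : σ ∪ J \ σ = J := Finset.union_sdiff_of_subset hσ
  have key := prod_sinToOthers_mul_norm_sum_le H x σ (J \ σ) Finset.disjoint_sdiff
    (by rwa [hunion])
  rw [hunion] at key
  rw [inv_mul_eq_div, le_div_iff₀' hδ]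
  exact (mul_le_mul_of_nonneg_right (hle _) (norm_nonneg _)).trans key
end

section
/- Let K_0, F_1, …, F_N be closed subspaces of a complex Hilbert space 𝓗. For each i = 1, …, N let S_{i−1} denote the closed linear span of K_0 ∪ F_1 ∪ … ∪ F_{i−1} (so S_0 is the closure of K_0), and let d_i := inf{ dist(f, S_{i−1})/‖f‖ : f ∈ F_i, f ≠ 0 }; assume d_i > 0 for every i. Then for every x_0 ∈ K_0 and every choice of vectors f_i ∈ F_i (i = 1, …, N), one has ‖x_0‖ ≤ (∏_{i=1}^{N} 1/d_i) · ‖x_0 + f_1 + ⋯ + f_N‖. -/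
open Metric

/-- The angle between two vectors is symmetric: if `f` stays at relative distance at least `d`
from the line through `s`, then `s` stays at relative distance at least `d` from `f`. -/
theorem mul_norm_le_norm_add_of_forall_mul_norm_le {𝓗 : Type*} [NormedAddCommGroup 𝓗]
    [InnerProductSpace ℂ 𝓗] {s f : 𝓗} {d : ℝ} (hd0 : 0 ≤ d) (hd1 : d ≤ 1)
    (h : ∀ c : ℂ, d * ‖f‖ ≤ ‖f + c • s‖) : d * ‖s‖ ≤ ‖s + f‖ := by
  rcases eq_or_ne s 0 with rfl | hs
  · simp
  rcases eq_or_ne f 0 with rfl | hf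
  · simpa using mul_le_of_le_one_left (norm_nonneg s) hd1
  have ha : 0 < ‖s‖ ^ 2 := by positivity
  have hb : 0 < ‖f‖ ^ 2 := by positivity
  set r : ℝ := RCLike.re (inner ℂ s f) with hr
  have hsf : ‖s + f‖ ^ 2 = ‖s‖ ^ 2 + 2 * r + ‖f‖ ^ 2 := norm_add_sq (𝕜 := ℂ) s f
  have hfs (t : ℝ) : ‖f + (t : ℂ) • s‖ ^ 2 = ‖f‖ ^ 2 + 2 * (t * r) + t ^ 2 * ‖s‖ ^ 2 := by
    rw [norm_add_sq (𝕜 := ℂ), inner_smul_right, norm_smul, mul_pow, Complex.norm_real,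
      Real.norm_eq_abs, sq_abs, hr, ← inner_re_symm f s]
    simp
  have hsq : r ^ 2 ≤ (1 - d ^ 2) * (‖s‖ ^ 2 * ‖f‖ ^ 2) := by
    have h1 := pow_le_pow_left₀ (by positivity) (h ((-r / ‖s‖ ^ 2 : ℝ) : ℂ)) 2
    rw [hfs, mul_pow] at h1
    have h2 : ‖f‖ ^ 2 + 2 * (-r / ‖s‖ ^ 2 * r) + (-r / ‖s‖ ^ 2) ^ 2 * ‖s‖ ^ 2
        = ‖f‖ ^ 2 - r ^ 2 / ‖s‖ ^ 2 := by
      field_simp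
      ring
    have h3 : r ^ 2 / ‖s‖ ^ 2 ≤ (1 - d ^ 2) * ‖f‖ ^ 2 := by linarith
    rw [div_le_iff₀ ha] at h3
    linarith
  refine le_of_sq_le_sq ?_ (norm_nonneg _)
  rw [hsf, mul_pow]
  refine le_of_mul_le_mul_left ?_ hb
  nlinarith [sq_nonneg (r + ‖f‖ ^ 2)]

/-- If `d` is the positive sine of the angle between `F` and `S`, then adding a vector of `F` to
a vector of `S` shrinks the norm by a factor of at most `d`. -/
theorem mul_norm_le_norm_add_of_eq_sInf {𝓗 : Type*} [NormedAddCommGroup 𝓗]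
    [InnerProductSpace ℂ 𝓗] {S F : Submodule ℂ 𝓗} {d : ℝ}
    (hd : d = sInf {r : ℝ | ∃ f : 𝓗, f ∈ F ∧ f ≠ 0 ∧ r = infDist f (S : Set 𝓗) / ‖f‖})
    (hdpos : 0 < d) {s f : 𝓗} (hs : s ∈ S) (hf : f ∈ F) : d * ‖s‖ ≤ ‖s + f‖ := by
  have hle {g : 𝓗} (hg : g ∈ F) {t : 𝓗} (ht : t ∈ S) : d * ‖g‖ ≤ ‖g + t‖ := by
    rcases eq_or_ne g 0 with rfl | hg0
    · simp
    have h1 : d ≤ infDist g (S : Set 𝓗) / ‖g‖ := by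
      rw [hd]
      refine csInf_le ⟨0, ?_⟩ ⟨g, hg, hg0, rfl⟩
      rintro _ ⟨u, -, -, rfl⟩
      exact div_nonneg infDist_nonneg (norm_nonneg u)
    rw [le_div_iff₀ (norm_pos_iff.2 hg0)] at h1
    refine h1.trans ((infDist_le_dist_of_mem (S.neg_mem ht)).trans_eq ?_)
    rw [dist_eq_norm, sub_neg_eq_add]
  have hd1 : d ≤ 1 := by
    have hne : {r : ℝ | ∃ f : 𝓗, f ∈ F ∧ f ≠ 0 ∧ r = infDist f (S : Set 𝓗) / ‖f‖}.Nonempty := by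
      rw [Set.nonempty_iff_ne_empty]
      intro h
      rw [h, Real.sInf_empty] at hd
      exact hdpos.ne' hd
    obtain ⟨_, g, hg, hg0, -⟩ := hne
    have := hle hg S.zero_mem
    rw [add_zero] at this
    exact (mul_le_iff_le_one_left (norm_pos_iff.2 hg0)).1 this
  exact mul_norm_le_norm_add_of_forall_mul_norm_le hdpos.le hd1 fun c ↦
    hle hf (S.smul_mem c hs)

theorem le_prod_mul_of_forall_le_mul {N : ℕ} {c : Fin N → ℝ} (hc : ∀ i, 0 ≤ c i) {p : ℕ → ℝ}
    (h : ∀ i : Fin N, p i ≤ c i * p (i + 1)) : p 0 ≤ (∏ i, c i) * p N := by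
  induction N with
  | zero => simp
  | succ n ih =>
    rw [Fin.prod_univ_castSucc, mul_assoc]
    refine (ih (fun i ↦ hc i.castSucc) fun i ↦ h i.castSucc).trans ?_
    exact mul_le_mul_of_nonneg_left (h (Fin.last n)) (Finset.prod_nonneg fun i _ ↦ hc _)

/-- successive angle estimates. `S i` is the closed linear span of
`K₀` together with the `F j` for `j < i` (so `S 0` is the closure of `K₀`), and
`d i` is the sine of the angle between `F i` and the closed span of `K₀` and the
previous `F j`'s. If all the `d i` are positive then
`‖x₀‖ ≤ (∏ i, 1 / d i) * ‖x₀ + f₁ + ⋯ + f_N‖`. -/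
theorem stmt_3 {𝓗 : Type*} [NormedAddCommGroup 𝓗] [InnerProductSpace ℂ 𝓗]
    [CompleteSpace 𝓗]
    (N : ℕ) (K₀ : Submodule ℂ 𝓗) (F : Fin N → Submodule ℂ 𝓗)
    (hK₀ : IsClosed (K₀ : Set 𝓗)) (hF : ∀ i, IsClosed ((F i : Set 𝓗)))
    (S : Fin N → Submodule ℂ 𝓗)
    (hS : ∀ i : Fin N,
      S i = (K₀ ⊔ ⨆ j : Fin N, ⨆ _ : (j : ℕ) < (i : ℕ), F j).topologicalClosure)
    (d : Fin N → ℝ)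
    (hd : ∀ i : Fin N,
      d i = sInf {r : ℝ | ∃ f : 𝓗, f ∈ F i ∧ f ≠ 0 ∧
        r = infDist f ((S i : Submodule ℂ 𝓗) : Set 𝓗) / ‖f‖})
    (hdpos : ∀ i, 0 < d i) :
    ∀ x₀ ∈ K₀, ∀ f : Fin N → 𝓗, (∀ i, f i ∈ F i) →
      ‖x₀‖ ≤ (∏ i, 1 / d i) * ‖x₀ + ∑ i, f i‖ := by
  intro x₀ hx₀ f hf
  set q : ℕ → 𝓗 := fun k ↦ x₀ + ∑ j : Fin N with j.val < k, f j with hq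
  have hq_succ (i : Fin N) : q (i + 1) = q i + f i := by
    have : (Finset.univ.filter fun j : Fin N ↦ j.val < i + 1)
        = insert i (Finset.univ.filter fun j : Fin N ↦ j.val < i) := by
      ext j
      simp only [Finset.mem_filter, Finset.mem_univ, true_and, Finset.mem_insert, Fin.ext_iff]
      omega
    simp only [hq]
    rw [this, Finset.sum_insert (by simp)]
    abel
  have hq_mem (i : Fin N) : q i ∈ S i := by
    rw [hS i]
    refine Submodule.le_topologicalClosure _ (Submodule.add_mem_sup hx₀ ?_)
    refine Submodule.sum_mem _ fun j hj ↦ ?_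
    exact Submodule.mem_iSup_of_mem j (Submodule.mem_iSup_of_mem (Finset.mem_filter.1 hj).2 (hf j))
  have key := le_prod_mul_of_forall_le_mul (c := fun i ↦ 1 / d i) (p := fun k ↦ ‖q k‖)
    (fun i ↦ (one_div_pos.2 (hdpos i)).le) fun i ↦ by
      rw [one_div_mul_eq_div, le_div_iff₀ (hdpos i), mul_comm, hq_succ]
      exact mul_norm_le_norm_add_of_eq_sInf (hd i) (hdpos i) (hq_mem i) (hf i)
  simpa [hq] using key
end
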